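/- Let (X_n, G_n), n = 1,2,…, be mm-spaces with closed subgroups G_n ⊆ Aut(X_n), and let Y be an mm-space such that □(X_n, Y) → 0 as n → ∞ (box convergence of the underlying mm-spaces). Then there exist a subsequence (n_j) and a closed subgroup H ⊆ Aut(Y) such that □((X_{n_j}, G_{n_j}), (Y, H)) → 0 as j → ∞. In other words, the projection (X,G) ↦ X from mm-spaces with closed group actions to mm-spaces is a proper map with respect to the box distances. -/

import Mathlib

open MeasureTheory Metric Filter Set TopologicalSpace
open scoped ENNReal Topology

noncomputable section

/-- The Ky Fan distance between two maps with respect to a measure: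
`inf { ε ≥ 0 | μ {ω | d(u ω, u' ω) > ε} ≤ ε }`. -/
def kyFan {Ω : Type*} [MeasurableSpace Ω] (μ : Measure Ω)
    {Z : Type*} [PseudoMetricSpace Z] (u u' : Ω → Z) : ℝ :=
  sInf {ε : ℝ | 0 ≤ ε ∧ μ {ω | ε < dist (u ω) (u' ω)} ≤ ENNReal.ofReal ε}

/-- `g` is an automorphism of the mm-space `(X, d, μ)`: a bijective isometry
preserving the measure. -/
def IsAut {X : Type*} [MetricSpace X] [MeasurableSpace X] (μ : Measure X) (g : X → X) : Prop :=
  Isometry g ∧ Function.Bijective g ∧ Measure.map g μ = μ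

/-- `G` is a subgroup of `Aut(X)` that is closed with respect to the Ky Fan metric
(equivalently, under convergence in `μ`-measure). -/
def IsClosedAutSubgroup {X : Type*} [MetricSpace X] [MeasurableSpace X]
    (μ : Measure X) (G : Set (X → X)) : Prop :=
  (∀ g ∈ G, IsAut μ g) ∧ (id ∈ G) ∧ (∀ g ∈ G, ∀ g' ∈ G, g ∘ g' ∈ G) ∧
  (∀ g ∈ G, ∃ g' ∈ G, g' ∘ g = id ∧ g ∘ g' = id) ∧
  (∀ (gs : ℕ → X → X) (g : X → X), (∀ n, gs n ∈ G) → IsAut μ g →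
    Tendsto (fun n => kyFan μ (gs n) g) atTop (𝓝 0) → g ∈ G)

/-- Couplings between two measures: measures on the product with the given marginals. -/
def couplings {X Y : Type*} [MeasurableSpace X] [MeasurableSpace Y]
    (μ : Measure X) (ν : Measure Y) : Set (Measure (X × Y)) :=
  {π | π.map Prod.fst = μ ∧ π.map Prod.snd = ν}

/-- The support of a Borel measure: points all of whose open neighborhoods have
positive measure. -/
def msupport {Z : Type*} [TopologicalSpace Z] [MeasurableSpace Z] (π : Measure Z) : Set Z :=
  {z | ∀ U : Set Z, IsOpen U → z ∈ U → 0 < π U}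

/-- `d^S(g,h) = sup_{((x₁,y₁),(x₂,y₂)) ∈ S × S} |d_X(g x₁, x₂) - d_Y(h y₁, y₂)|`,
with value `0` for `S = ∅`. -/
def dS {X Y : Type*} [MetricSpace X] [MetricSpace Y]
    (S : Set (X × Y)) (g : X → X) (h : Y → Y) : ℝ≥0∞ :=
  ⨆ p ∈ S ×ˢ S, ENNReal.ofReal |dist (g p.1.1) p.2.1 - dist (h p.1.2) p.2.2|

/-- `d^π(g,h) = inf { max(1 - π S, d^S(g,h)) | S ⊆ supp π closed }`. -/
def dPi {X Y : Type*} [MetricSpace X] [MetricSpace Y] [MeasurableSpace X] [MeasurableSpace Y]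
    (π : Measure (X × Y)) (g : X → X) (h : Y → Y) : ℝ≥0∞ :=
  ⨅ S ∈ {S : Set (X × Y) | IsClosed S ∧ S ⊆ msupport π}, max (1 - π S) (dS S g h)

/-- `□^π((X,G),(Y,H))`: the Hausdorff distance between `G` and `H` w.r.t. `d^π`. -/
def boxPi {X Y : Type*} [MetricSpace X] [MetricSpace Y] [MeasurableSpace X] [MeasurableSpace Y]
    (π : Measure (X × Y)) (G : Set (X → X)) (H : Set (Y → Y)) : ℝ≥0∞ :=
  max (⨆ g ∈ G, ⨅ h ∈ H, dPi π g h) (⨆ h ∈ H, ⨅ g ∈ G, dPi π g h)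

/-- The equivariant box distance `□((X,G),(Y,H)) = inf_{π ∈ Π(μ,ν)} □^π((X,G),(Y,H))`. -/
def eqBox {X Y : Type*} [MetricSpace X] [MetricSpace Y] [MeasurableSpace X] [MeasurableSpace Y]
    (μ : Measure X) (ν : Measure Y) (G : Set (X → X)) (H : Set (Y → Y)) : ℝ≥0∞ :=
  ⨅ π ∈ couplings μ ν, boxPi π G H

/-- The set of real-valued 1-Lipschitz functions. -/
def Lip1 (X : Type*) [PseudoMetricSpace X] : Set (X → ℝ) := {f | LipschitzWith 1 f}

/-- `ρ^π_{g,h}(f,f') = max( d_KF^π(f∘p₁, f'∘p₂), d_KF^π(f∘g∘p₁, f'∘h∘p₂) )`. -/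
def rhoPair {X Y : Type*} [MetricSpace X] [MetricSpace Y] [MeasurableSpace X] [MeasurableSpace Y]
    (π : Measure (X × Y)) (g : X → X) (h : Y → Y) (f : X → ℝ) (f' : Y → ℝ) : ℝ :=
  max (kyFan π (fun p => f p.1) (fun p => f' p.2))
      (kyFan π (fun p => f (g p.1)) (fun p => f' (h p.2)))

/-- `ρ^π(g,h)`: the Hausdorff distance between `Lip₁(X)` and `Lip₁(Y)` w.r.t. `ρ^π_{g,h}`. -/
def rhoPi {X Y : Type*} [MetricSpace X] [MetricSpace Y] [MeasurableSpace X] [MeasurableSpace Y]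
    (π : Measure (X × Y)) (g : X → X) (h : Y → Y) : ℝ :=
  max (⨆ f ∈ Lip1 X, ⨅ f' ∈ Lip1 Y, rhoPair π g h f f')
      (⨆ f' ∈ Lip1 Y, ⨅ f ∈ Lip1 X, rhoPair π g h f f')

/-- `d_conc^π((X,G),(Y,H))`: the Hausdorff distance between `G` and `H` w.r.t. `ρ^π`. -/
def dconcPi {X Y : Type*} [MetricSpace X] [MetricSpace Y] [MeasurableSpace X] [MeasurableSpace Y]
    (π : Measure (X × Y)) (G : Set (X → X)) (H : Set (Y → Y)) : ℝ :=
  max (⨆ g ∈ G, ⨅ h ∈ H, rhoPi π g h) (⨆ h ∈ H, ⨅ g ∈ G, rhoPi π g h)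

/-- The equivariant observable distance
`d_conc((X,G),(Y,H)) = inf_{π ∈ Π(μ,ν)} d_conc^π((X,G),(Y,H))`. -/
def eqDconc {X Y : Type*} [MetricSpace X] [MetricSpace Y] [MeasurableSpace X] [MeasurableSpace Y]
    (μ : Measure X) (ν : Measure Y) (G : Set (X → X)) (H : Set (Y → Y)) : ℝ :=
  ⨅ π ∈ couplings μ ν, dconcPi π G H

/-- `(X,G)` and `(Y,H)` are equivariantly mm-isomorphic: there is a measure-preserving
bijective isometry `φ : X → Y` equivariant with respect to a group isomorphism `G → H`. -/
def EquivMMIso {X Y : Type*} [MetricSpace X] [MetricSpace Y] [MeasurableSpace X] [MeasurableSpace Y]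
    (μ : Measure X) (ν : Measure Y) (G : Set (X → X)) (H : Set (Y → Y)) : Prop :=
  ∃ φ : X → Y, Isometry φ ∧ Function.Bijective φ ∧ Measure.map φ μ = ν ∧
    ∃ ρ : (X → X) → (Y → Y), Set.BijOn ρ G H ∧
      (∀ g ∈ G, ∀ g' ∈ G, ρ (g ∘ g') = ρ g ∘ ρ g') ∧
      (∀ g ∈ G, ∀ x, φ (g x) = ρ g (φ x))

/-- The Prokhorov (Lévy–Prokhorov) distance between two Borel measures. -/
def prokhorov {X : Type*} [PseudoMetricSpace X] [MeasurableSpace X] (μ ν : Measure X) : ℝ :=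
  sInf {ε : ℝ | 0 < ε ∧ ∀ A : Set X, MeasurableSet A →
    μ A ≤ ν (Metric.thickening ε A) + ENNReal.ofReal ε ∧
    ν A ≤ μ (Metric.thickening ε A) + ENNReal.ofReal ε}

/-- The κ-observable diameter `ObsDiam(X;-κ) = sup_{f ∈ Lip₁(X)} diam(f_*μ; -κ)`. -/
def obsDiam {X : Type*} [MetricSpace X] [MeasurableSpace X] (μ : Measure X) (κ : ℝ) : ℝ≥0∞ :=
  ⨆ f ∈ Lip1 X,
    ⨅ A ∈ {A : Set ℝ | MeasurableSet A ∧ 1 - ENNReal.ofReal κ ≤ μ.map f A}, EMetric.diam A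

/-- Weak Hausdorff convergence of a sequence of (closed) subsets, with the
convention `d(x, ∅) = ∞` (via `EMetric.infEdist`). -/
def WeakHausTendsto {X : Type*} [MetricSpace X] (S : ℕ → Set X) (T : Set X) : Prop :=
  (∀ x ∈ T, Tendsto (fun n => EMetric.infEdist x (S n)) atTop (𝓝 0)) ∧
  (∀ x ∉ T, 0 < Filter.liminf (fun n => EMetric.infEdist x (S n)) atTop)


/-- `g` and `h` are `ε`-related through `π`: outside a set of `π`-measure at most `ε`,
the distances `d(g x₁, x₂)` and `d(h y₁, y₂)` differ by at most `ε`. -/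
def Approx {X Y : Type*} [MetricSpace X] [MetricSpace Y] [MeasurableSpace X] [MeasurableSpace Y]
    (π : Measure (X × Y)) (g : X → X) (h : Y → Y) (ε : ℝ) : Prop :=
  ∃ S : Set (X × Y), π.real Sᶜ ≤ ε ∧
    ∀ p ∈ S, ∀ q ∈ S, |dist (g p.1) q.1 - dist (h p.2) q.2| ≤ ε

/-- `h` and `h'` are at distance at most `η` outside a set of `ν`-measure at most `η`. -/
def CloseInMeasure {Y : Type*} [MetricSpace Y] [MeasurableSpace Y] (ν : Measure Y)
    (h h' : Y → Y) (η : ℝ) : Prop :=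
  ν.real {y | η < dist (h y) (h' y)} ≤ η

section Basic

variable {X Y : Type*} [MetricSpace X] [MetricSpace Y] [MeasurableSpace X] [MeasurableSpace Y]
  {π : Measure (X × Y)} {μ : Measure X} {ν : Measure Y}
  {g g' : X → X} {h h' : Y → Y} {ε ε' η : ℝ}

lemma Approx.mono (H : Approx π g h ε) (hε : ε ≤ ε') : Approx π g h ε' := by
  obtain ⟨S, h1, h2⟩ := H
  exact ⟨S, h1.trans hε, fun p hp q hq => (h2 p hp q hq).trans hε⟩

lemma approx_one [IsProbabilityMeasure π] : Approx π g h 1 :=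
  ⟨∅, by simp, by simp⟩

lemma isProbabilityMeasure_of_mem_couplings [IsProbabilityMeasure μ] (hπ : π ∈ couplings μ ν) :
    IsProbabilityMeasure π := by
  refine ⟨?_⟩
  rw [← measure_univ (μ := μ), ← hπ.1, Measure.map_apply measurable_fst MeasurableSet.univ,
    preimage_univ]

lemma prod_mem_couplings [IsProbabilityMeasure μ] [IsProbabilityMeasure ν] :
    μ.prod ν ∈ couplings μ ν := by
  constructor
  · simp
  · simp

lemma measureReal_fst_preimage (hπ : π ∈ couplings μ ν) {A : Set X} (hA : MeasurableSet A) :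
    π.real (Prod.fst ⁻¹' A) = μ.real A := by
  rw [← hπ.1, map_measureReal_apply measurable_fst hA]

lemma measureReal_snd_preimage (hπ : π ∈ couplings μ ν) {B : Set Y} (hB : MeasurableSet B) :
    π.real (Prod.snd ⁻¹' B) = ν.real B := by
  rw [← hπ.2, map_measureReal_apply measurable_snd hB]

lemma measureReal_le_of_fst_snd [IsProbabilityMeasure π] (hπ : π ∈ couplings μ ν)
    {S : Set (X × Y)} {A : Set X} {B : Set Y} (hA : MeasurableSet A) (hB : MeasurableSet B)
    (hAB : ∀ p ∈ S, p.1 ∈ A → p.2 ∈ B) : μ.real A ≤ ν.real B + π.real Sᶜ := by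
  rw [← measureReal_fst_preimage hπ hA, ← measureReal_snd_preimage hπ hB]
  refine (measureReal_mono ?_).trans (measureReal_union_le _ _)
  intro p hp
  by_cases hS : p ∈ S
  · exact Or.inl (hAB p hS hp)
  · exact Or.inr hS

lemma measureReal_le_of_snd_fst [IsProbabilityMeasure π] (hπ : π ∈ couplings μ ν)
    {S : Set (X × Y)} {A : Set X} {B : Set Y} (hA : MeasurableSet A) (hB : MeasurableSet B)
    (hAB : ∀ p ∈ S, p.2 ∈ B → p.1 ∈ A) : ν.real B ≤ μ.real A + π.real Sᶜ := by
  rw [← measureReal_fst_preimage hπ hA, ← measureReal_snd_preimage hπ hB]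
  refine (measureReal_mono ?_).trans (measureReal_union_le _ _)
  intro p hp
  by_cases hS : p ∈ S
  · exact Or.inl (hAB p hS hp)
  · exact Or.inr hS

lemma exists_fst_mem_of_lt [IsProbabilityMeasure π] (hπ : π ∈ couplings μ ν)
    {S : Set (X × Y)} {A : Set X} (hA : MeasurableSet A) (h : π.real Sᶜ < μ.real A) :
    ∃ p ∈ S, p.1 ∈ A := by
  by_contra! hne
  have := measureReal_le_of_fst_snd (S := S) hπ hA MeasurableSet.empty
    (fun p hp hpA => (hne p hp hpA).elim)
  simp at this
  linarith

lemma exists_snd_mem_of_lt [IsProbabilityMeasure π] (hπ : π ∈ couplings μ ν)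
    {S : Set (X × Y)} {B : Set Y} (hB : MeasurableSet B) (h : π.real Sᶜ < ν.real B) :
    ∃ p ∈ S, p.2 ∈ B := by
  by_contra! hne
  have := measureReal_le_of_snd_fst (S := S) hπ MeasurableSet.empty hB
    (fun p hp hpA => (hne p hp hpA).elim)
  simp at this
  linarith

lemma IsAut.measureReal_preimage [BorelSpace X] (hg : IsAut μ g) {A : Set X}
    (hA : MeasurableSet A) : μ.real (g ⁻¹' A) = μ.real A := by
  conv_rhs => rw [← hg.2.2]
  rw [map_measureReal_apply hg.1.continuous.measurable hA]

lemma IsAut.measureReal_ball [BorelSpace X] (hg : IsAut μ g) (x : X) (r : ℝ) :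
    μ.real (ball (g x) r) = μ.real (ball x r) := by
  rw [← hg.measureReal_preimage measurableSet_ball, hg.1.preimage_ball]

lemma isAut_id : IsAut μ (id : X → X) :=
  ⟨isometry_id, Function.bijective_id, Measure.map_id⟩

lemma IsAut.comp [BorelSpace X] (hg : IsAut μ g) (hg' : IsAut μ g') : IsAut μ (g ∘ g') := by
  refine ⟨hg.1.comp hg'.1, hg.2.1.comp hg'.2.1, ?_⟩
  rw [← Measure.map_map hg.1.continuous.measurable hg'.1.continuous.measurable, hg'.2.2, hg.2.2]

lemma IsAut.exists_inverse [BorelSpace X] (hg : IsAut μ g) :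
    ∃ g', IsAut μ g' ∧ g' ∘ g = id ∧ g ∘ g' = id := by
  obtain ⟨g', hl, hr⟩ := Function.bijective_iff_has_inverse.1 hg.2.1
  have hiso : Isometry g' := hg.1.right_inv hr
  refine ⟨g', ⟨hiso, ⟨hr.injective, hl.surjective⟩, ?_⟩, hl.comp_eq_id, hr.comp_eq_id⟩
  conv_lhs => rw [← hg.2.2]
  rw [Measure.map_map hiso.continuous.measurable hg.1.continuous.measurable, hl.comp_eq_id,
    Measure.map_id]

lemma measure_compl_msupport {Z : Type*} [TopologicalSpace Z] [SecondCountableTopology Z]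
    [MeasurableSpace Z] (τ : Measure Z) : τ (msupport τ)ᶜ = 0 := by
  have : msupport τ = τ.support := by
    ext z
    rw [Measure.mem_support_iff_forall]
    refine ⟨fun hz U hU => ?_, fun hz U hU hzU => hz U (hU.mem_nhds hzU)⟩
    obtain ⟨V, hVU, hV, hzV⟩ := mem_nhds_iff.1 hU
    exact (hz V hV hzV).trans_le (measure_mono hVU)
  rw [this]
  exact Measure.measure_compl_support

lemma isClosed_msupport {Z : Type*} [TopologicalSpace Z] [MeasurableSpace Z] (τ : Measure Z) :
    IsClosed (msupport τ) := by
  rw [← isOpen_compl_iff, isOpen_iff_forall_mem_open]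
  intro z hz
  simp only [msupport, mem_compl_iff, mem_ofPred_eq, not_forall] at hz
  obtain ⟨U, hU, hzU, h0⟩ := hz
  exact ⟨U, fun w hw hw' => h0 (hw' U hU hw), hU, hzU⟩

lemma approx_of_dPi_lt [OpensMeasurableSpace (X × Y)] [IsProbabilityMeasure π] (hε : 0 ≤ ε)
    (H : dPi π g h < ENNReal.ofReal ε) :
    Approx π g h ε := by
  simp only [dPi, iInf_lt_iff, max_lt_iff] at H
  obtain ⟨S, hS, h1, h2⟩ := H
  refine ⟨S, ?_, fun p hp q hq => ?_⟩
  · rw [← prob_compl_eq_one_sub hS.1.measurableSet] at h1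
    exact ENNReal.toReal_le_of_le_ofReal hε h1.le
  · have : ENNReal.ofReal |dist (g p.1) q.1 - dist (h p.2) q.2| ≤ dS S g h :=
      le_iSup₂_of_le (p, q) (mk_mem_prod hp hq) le_rfl
    exact (ENNReal.ofReal_le_ofReal_iff hε).1 (this.trans h2.le)

lemma Approx.dPi_le [SecondCountableTopology (X × Y)] [OpensMeasurableSpace (X × Y)]
    [IsProbabilityMeasure π] (hg : Continuous g) (hh : Continuous h) (H : Approx π g h ε) :
    dPi π g h ≤ ENNReal.ofReal ε := by
  obtain ⟨S, h1, h2⟩ := H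
  have hclosed : IsClosed (closure S ∩ msupport π) := isClosed_closure.inter (isClosed_msupport π)
  refine iInf₂_le_of_le (closure S ∩ msupport π) ⟨hclosed, inter_subset_right⟩ (max_le ?_ ?_)
  · rw [← prob_compl_eq_one_sub hclosed.measurableSet, compl_inter]
    refine (measure_union_le _ _).trans ?_
    rw [measure_compl_msupport, add_zero]
    refine (measure_mono (compl_subset_compl.2 subset_closure)).trans ?_
    rw [← ofReal_measureReal]
    exact ENNReal.ofReal_le_ofReal h1
  · refine iSup₂_le fun p hp => ENNReal.ofReal_le_ofReal ?_
    have hc : IsClosed {p : (X × Y) × (X × Y) |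
        |dist (g p.1.1) p.2.1 - dist (h p.1.2) p.2.2| ≤ ε} :=
      isClosed_le (by fun_prop) continuous_const
    have hsub : closure (S ×ˢ S) ⊆ _ := closure_minimal (fun p hp => h2 p.1 hp.1 p.2 hp.2) hc
    rw [closure_prod_eq] at hsub
    exact hsub ⟨hp.1.1, hp.2.1⟩

lemma Approx.of_closeInMeasure [IsProbabilityMeasure π] (hπ : π ∈ couplings μ ν)
    [OpensMeasurableSpace Y] [SecondCountableTopology Y] (hh : Continuous h) (hh' : Continuous h')
    (H : Approx π g h ε) (hc : CloseInMeasure ν h h' η) : Approx π g h' (ε + η) := by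
  obtain ⟨S, h1, h2⟩ := H
  have hm : MeasurableSet {y | η < dist (h y) (h' y)} :=
    (isOpen_lt continuous_const (by fun_prop)).measurableSet
  refine ⟨S ∩ Prod.snd ⁻¹' {y | η < dist (h y) (h' y)}ᶜ, ?_, fun p hp q hq => ?_⟩
  · rw [compl_inter, preimage_compl, compl_compl]
    refine (measureReal_union_le _ _).trans ?_
    rw [measureReal_snd_preimage hπ hm]
    exact add_le_add h1 hc
  · have h3 := abs_le.1 (h2 p hp.1 q hq.1)
    have h4 : dist (h p.2) (h' p.2) ≤ η := not_lt.1 hp.2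
    have h5 := abs_le.1 (abs_dist_sub_le (h p.2) (h' p.2) q.2)
    rw [abs_le]
    constructor <;> linarith

lemma CloseInMeasure.symm (hc : CloseInMeasure ν h h' η) : CloseInMeasure ν h' h η := by
  simpa only [CloseInMeasure, dist_comm] using hc

lemma CloseInMeasure.mono [IsProbabilityMeasure ν] (hc : CloseInMeasure ν h h' ε) (hε : ε ≤ ε') :
    CloseInMeasure ν h h' ε' := by
  refine le_trans (measureReal_mono fun y hy => ?_) (le_trans hc hε)
  exact hε.trans_lt hy

lemma closeInMeasure_of_kyFan_lt [IsProbabilityMeasure ν] (H : kyFan ν h h' < η) :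
    CloseInMeasure ν h h' η := by
  obtain ⟨ε, ⟨h0, hε⟩, hlt⟩ := exists_lt_of_csInf_lt
    (s := {ε : ℝ | 0 ≤ ε ∧ ν {ω | ε < dist (h ω) (h' ω)} ≤ ENNReal.ofReal ε})
    ⟨1, zero_le_one, by simpa using prob_le_one⟩ H
  have : CloseInMeasure ν h h' ε := ENNReal.toReal_le_of_le_ofReal h0 hε
  exact this.mono hlt.le

lemma Approx.inverse (hg : Isometry g) (hh : Isometry h) (hgg' : g ∘ g' = id) (hhh' : h ∘ h' = id)
    (H : Approx π g h ε) : Approx π g' h' ε := by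
  obtain ⟨S, h1, h2⟩ := H
  refine ⟨S, h1, fun p hp q hq => ?_⟩
  have e1 : g (g' p.1) = p.1 := congrFun hgg' _
  have e2 : h (h' p.2) = p.2 := congrFun hhh' _
  rw [← hg.dist_eq, ← hh.dist_eq, e1, e2, dist_comm p.1, dist_comm p.2]
  exact h2 q hq p hp

/-- The pairs of `T` whose first component is moved by `g` close to the first projection
of `T` still have large measure. -/
lemma measureReal_compl_near_le [BorelSpace X] [IsProbabilityMeasure π] (hπ : π ∈ couplings μ ν)
    (hg : IsAut μ g) (T : Set (X × Y)) (hε : 0 < ε) :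
    π.real {p | p ∈ T ∧ ∃ q ∈ T, dist (g p.1) q.1 < ε}ᶜ ≤ 2 * π.real Tᶜ := by
  set A := thickening ε (Prod.fst '' T) with hA
  have hAm : MeasurableSet A := isOpen_thickening.measurableSet
  have hsub : {p | p ∈ T ∧ ∃ q ∈ T, dist (g p.1) q.1 < ε}ᶜ ⊆ Tᶜ ∪ Prod.fst ⁻¹' (g ⁻¹' Aᶜ) := by
    intro p hp
    by_cases hT : p ∈ T
    · refine Or.inr fun hpA => hp ⟨hT, ?_⟩
      obtain ⟨_, ⟨q, hq, rfl⟩, hd⟩ := mem_thickening_iff.1 hpA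
      exact ⟨q, hq, hd⟩
    · exact Or.inl hT
  have h1 : π.real (Prod.fst ⁻¹' (g ⁻¹' Aᶜ)) ≤ π.real Tᶜ := by
    rw [measureReal_fst_preimage hπ (hg.1.continuous.measurable hAm.compl),
      hg.measureReal_preimage hAm.compl, ← measureReal_fst_preimage hπ hAm.compl]
    exact measureReal_mono fun p hp hT => hp (self_subset_thickening hε _ ⟨p, hT, rfl⟩)
  linarith [(measureReal_mono (μ := π) hsub).trans (measureReal_union_le _ _)]

lemma Approx.comp [BorelSpace X] [IsProbabilityMeasure π] (hπ : π ∈ couplings μ ν)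
    (hg : Isometry g) (hg' : IsAut μ g') (hh : Isometry h) (hε : 0 < ε)
    (H : Approx π g h ε) (H' : Approx π g' h' ε) : Approx π (g ∘ g') (h ∘ h') (4 * ε) := by
  obtain ⟨S, h1, h2⟩ := H
  obtain ⟨S', h1', h2'⟩ := H'
  have hT : π.real (S ∩ S')ᶜ ≤ 2 * ε := by
    rw [compl_inter]
    linarith [measureReal_union_le (μ := π) Sᶜ S'ᶜ]
  refine ⟨_, (measureReal_compl_near_le hπ hg' (S ∩ S') hε).trans (by linarith), ?_⟩
  rintro p ⟨hp, r, hr, hpr⟩ q ⟨hq, -⟩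
  have a1 := abs_le.1 (h2' p hp.2 r hr.2)
  have a2 := abs_le.1 (h2 r hr.1 q hq.1)
  have a3 := abs_le.1 (abs_dist_sub_le (g (g' p.1)) (g r.1) q.1)
  have a4 := abs_le.1 (abs_dist_sub_le (h (h' p.2)) (h r.2) q.2)
  rw [hg.dist_eq] at a3
  rw [hh.dist_eq] at a4
  rw [abs_le]
  simp only [Function.comp_apply]
  constructor <;> linarith

/-- Approximation by measure-preserving maps forces the limit map to be almost
measure nonincreasing. -/
lemma Approx.measureReal_preimage_le [BorelSpace X] [BorelSpace Y] [IsProbabilityMeasure π]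
    (hπ : π ∈ couplings μ ν)
    (hg : IsAut μ g) (hh : Continuous h) (hε : 0 < ε)
    (H : Approx π g h ε) (H' : Approx π id id ε) {F : Set Y} (hF : MeasurableSet F) :
    ν.real (h ⁻¹' F) ≤ ν.real (thickening (4 * ε) F) + 6 * ε := by
  obtain ⟨S, h1, h2⟩ := H
  obtain ⟨S', h1', h2'⟩ := H'
  set T := S ∩ S' with hTdef
  have hT : π.real Tᶜ ≤ 2 * ε := by
    rw [hTdef, compl_inter]
    linarith [measureReal_union_le (μ := π) Sᶜ S'ᶜ]
  set A := thickening ε (Prod.fst '' (T ∩ Prod.snd ⁻¹' thickening (2 * ε) F))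
  have hA : MeasurableSet A := isOpen_thickening.measurableSet
  have h3 : ν.real (h ⁻¹' F) ≤ μ.real (g ⁻¹' A) + _ :=
    measureReal_le_of_snd_fst hπ (S := {p | p ∈ T ∧ ∃ q ∈ T, dist (g p.1) q.1 < ε})
    (hg.1.continuous.measurable hA) (hh.measurable hF) (by
      rintro p ⟨hp, q, hq, hpq⟩ hpF
      refine mem_thickening_iff.2 ⟨q.1, ⟨q, ⟨hq, mem_thickening_iff.2 ⟨h p.2, hpF, ?_⟩⟩, rfl⟩, hpq⟩
      rw [dist_comm]
      linarith [abs_le.1 (h2 p hp.1 q hq.1)])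
  have h4 := measureReal_compl_near_le hπ hg T hε
  rw [hg.measureReal_preimage hA] at h3
  have h5 : μ.real A ≤ ν.real (thickening (4 * ε) F) + π.real Tᶜ :=
    measureReal_le_of_fst_snd hπ hA isOpen_thickening.measurableSet (by
      intro p hp hpA
      obtain ⟨_, ⟨q, ⟨hq, hqF⟩, rfl⟩, hd⟩ := mem_thickening_iff.1 hpA
      obtain ⟨z, hz, hqz⟩ := mem_thickening_iff.1 hqF
      refine mem_thickening_iff.2 ⟨z, hz, ?_⟩
      have := abs_le.1 (h2' p hp.2 q hq.2)
      simp only [id] at this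
      linarith [dist_triangle p.2 q.2 z])
  linarith

end Basic

section Limit

variable {Y : Type*} [MetricSpace Y] [MeasurableSpace Y] [BorelSpace Y]
  {ν : Measure Y}

lemma exists_finite_cover_measureReal_compl_lt [IsProbabilityMeasure ν] {u : ℕ → Y}
    (hu : DenseRange u) {r η : ℝ} (hr : 0 < r) (hη : 0 < η) :
    ∃ N : ℕ, ν.real (⋃ i ≤ N, ball (u i) r)ᶜ < η := by
  have huniv : ⋃ i, ball (u i) r = univ := by
    refine eq_univ_of_forall fun y => ?_
    obtain ⟨i, hi⟩ := hu.exists_dist_lt y hr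
    exact mem_iUnion.2 ⟨i, hi⟩
  have h1 := tendsto_measure_iUnion_accumulate (μ := ν) (f := fun i => ball (u i) r)
  rw [huniv] at h1
  have h2 := (ENNReal.tendsto_toReal (measure_ne_top ν univ)).comp h1
  simp only [measure_univ, ENNReal.toReal_one] at h2
  obtain ⟨N, hN⟩ := (h2.eventually (lt_mem_nhds (show 1 - η < 1 by linarith))).exists
  refine ⟨N, ?_⟩
  have hm : MeasurableSet (⋃ i ≤ N, ball (u i) r) :=
    MeasurableSet.biUnion (to_countable _) fun i _ => measurableSet_ball
  rw [probReal_compl_eq_one_sub hm]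
  have : 1 - η < ν.real (⋃ i ≤ N, ball (u i) r) := hN
  linarith

lemma exists_isometry_extension {Y Z : Type*} [MetricSpace Y] [MetricSpace Z] [CompleteSpace Z]
    {u : ℕ → Y} (hu : DenseRange u) {v : ℕ → Z} (huv : ∀ i j, dist (v i) (v j) = dist (u i) (u j)) :
    ∃ h : Y → Z, Isometry h ∧ ∀ i, h (u i) = v i := by
  choose k hk using fun x : range u => x.2
  have hiso : Isometry (fun x : range u => v (k x)) := Isometry.of_dist_eq fun x y => by
    rw [huv, hk, hk]; rfl
  have hdr : DenseRange ((↑) : range u → Y) := by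
    rw [DenseRange, Subtype.range_coe]; exact hu
  have hind : IsUniformInducing ((↑) : range u → Y) := isUniformInducing_val _
  have hdi := hind.isDenseInducing hdr
  have hcont : Continuous (hdi.extend fun x : range u => v (k x)) :=
    (uniformContinuous_uniformly_extend hind hdr hiso.uniformContinuous).continuous
  have hval : ∀ i, hdi.extend (fun x : range u => v (k x)) (u i) = v i := fun i => by
    have := hdi.extend_eq hiso.continuous ⟨u i, mem_range_self i⟩
    rw [this, ← dist_eq_zero, huv, hk, dist_self]
  refine ⟨_, Isometry.of_dist_eq fun x y => ?_, hval⟩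
  refine hu.induction_on₂ (p := fun x y => dist (hdi.extend (fun x : range u => v (k x)) x)
    (hdi.extend (fun x : range u => v (k x)) y) = dist x y) ?_ (fun i j => ?_) x y
  · exact isClosed_eq (by fun_prop) (by fun_prop)
  · rw [hval, hval, huv]

lemma totallyBounded_range_of_eventually {Z : Type*} [MetricSpace Z] {z : ℕ → Z}
    (hz : ∀ ε > 0, ∃ t : Set Z, t.Finite ∧ ∀ᶠ n in atTop, ∃ y ∈ t, dist (z n) y < ε) :
    TotallyBounded (range z) := by
  refine Metric.totallyBounded_iff.2 fun ε hε => ?_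
  obtain ⟨t, ht, hev⟩ := hz ε hε
  obtain ⟨N, hN⟩ := eventually_atTop.1 hev
  refine ⟨t ∪ z '' Iio N, ht.union ((finite_Iio N).image z), ?_⟩
  rintro _ ⟨n, rfl⟩
  rcases lt_or_ge n N with hn | hn
  · exact mem_biUnion (Or.inr ⟨n, hn, rfl⟩) (mem_ball_self hε)
  · obtain ⟨y, hy, hd⟩ := hN n hn
    exact mem_biUnion (Or.inl hy) hd

lemma exists_dense_seq_isAut [SecondCountableTopology Y] [IsProbabilityMeasure ν] :
    ∃ D : ℕ → Y → Y, (∀ k, IsAut ν (D k)) ∧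
      ∀ h, IsAut ν h → ∀ η > 0, ∃ k, CloseInMeasure ν h (D k) η := by
  have : Nonempty Y := nonempty_of_isProbabilityMeasure ν
  set u := denseSeq Y
  have hu : DenseRange u := denseRange_denseSeq Y
  set A : Set (ℕ → Y) := (fun h : Y → Y => h ∘ u) '' {h | IsAut ν h}
  obtain ⟨t, htA, htc, hAt⟩ := (IsSeparable.of_separableSpace A).exists_countable_dense_subset
  have hAne : A.Nonempty := ⟨_, id, isAut_id, rfl⟩
  have htne : t.Nonempty := closure_nonempty_iff.1 (hAne.mono hAt)
  obtain ⟨f, rfl⟩ := htc.exists_eq_range htne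
  choose D hD hDf using fun k => htA (mem_range_self k)
  refine ⟨D, hD, fun h hh η hη => ?_⟩
  have hη3 : 0 < η / 3 := by positivity
  obtain ⟨N, hN⟩ := exists_finite_cover_measureReal_compl_lt (ν := ν) hu hη3 hη
  have hmem : h ∘ u ∈ closure (range f) := hAt ⟨h, hh, rfl⟩
  have hopen : IsOpen {v : ℕ → Y | ∀ i ∈ Iic N, dist (h (u i)) (v i) < η / 3} := by
    have : {v : ℕ → Y | ∀ i ∈ Iic N, dist (h (u i)) (v i) < η / 3} =
        ⋂ i ∈ Iic N, {v : ℕ → Y | dist (h (u i)) (v i) < η / 3} := by ext; simp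
    rw [this]
    exact (finite_Iic N).isOpen_biInter fun i _ => isOpen_lt (by fun_prop) continuous_const
  obtain ⟨_, hv, k, rfl⟩ := mem_closure_iff.1 hmem _ hopen (fun i _ => by simpa using hη3)
  refine ⟨k, (measureReal_mono fun y hy hyc => ?_).trans hN.le⟩
  simp only [mem_iUnion] at hyc
  obtain ⟨i, hi, hyi⟩ := hyc
  have h1 := hv i hi
  rw [← hDf k] at h1
  simp only [Function.comp_apply] at h1
  have h2 : dist (h y) (h (u i)) < η / 3 := by rw [hh.1.dist_eq]; exact hyi
  have h3 : dist (D k y) (D k (u i)) < η / 3 := by rw [(hD k).1.dist_eq]; exact hyi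
  have h4 := dist_triangle4_right (h y) (D k y) (h (u i)) (D k (u i))
  have h5 : η < dist (h y) (D k y) := hy
  linarith

lemma isAut_of_measureReal_preimage_le [CompleteSpace Y] [IsProbabilityMeasure ν]
    [ν.IsOpenPosMeasure] {h : Y → Y} (hh : Isometry h)
    (H : ∀ F, IsClosed F → ν.real (h ⁻¹' F) ≤ ν.real F) : IsAut ν h := by
  have hm : Measurable h := hh.continuous.measurable
  have : IsProbabilityMeasure (ν.map h) := Measure.isProbabilityMeasure_map hm.aemeasurable
  have hle : ν.map h ≤ ν := by
    refine Measure.le_iff.2 fun A hA => ?_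
    rw [hA.measure_eq_iSup_isClosed_of_ne_top (measure_ne_top _ _)]
    refine iSup_le fun K => iSup_le fun hKA => iSup_le fun hK => ?_
    rw [Measure.map_apply hm hK.measurableSet]
    have := (ENNReal.toReal_le_toReal (measure_ne_top _ _) (measure_ne_top _ _)).1 (H K hK)
    exact this.trans (measure_mono hKA)
  have heq : ν.map h = ν := Measure.eq_of_le_of_isProbabilityMeasure hle
  refine ⟨hh, ⟨hh.injective, ?_⟩, heq⟩
  have hcl : IsClosed (range h) := hh.isClosedEmbedding.isClosed_range
  have h0 : ν (range h)ᶜ = 0 := by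
    conv_lhs => rw [← heq]
    rw [Measure.map_apply hm hcl.measurableSet.compl]
    simp
  have := (hcl.isOpen_compl.measure_eq_zero_iff ν).1 h0
  rw [← range_eq_univ, ← compl_empty_iff, this]

end Limit

section Compactness

lemma exists_mem_dist_lt_infDist_add {Z W : Type*} [Nonempty Z] [MetricSpace W] (S : Set Z)
    (f : Z → W) (w : W) {r : ℝ} (hr : 0 < r) :
    ∃ p, S.Nonempty → p ∈ S ∧ dist w (f p) < infDist w (f '' S) + r := by
  by_cases hS : S.Nonempty
  · obtain ⟨_, ⟨p, hp, rfl⟩, hd⟩ :=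
      (infDist_lt_iff (hS.image f)).1 (lt_add_of_pos_right (infDist w (f '' S)) hr)
    exact ⟨p, fun _ => ⟨hp, hd⟩⟩
  · exact ⟨Classical.arbitrary Z, fun h => (hS h).elim⟩

variable {Y : Type*} [MetricSpace Y] [CompleteSpace Y] [SecondCountableTopology Y]
  [MeasurableSpace Y] [BorelSpace Y] {ν : Measure Y} [IsProbabilityMeasure ν]
  [ν.IsOpenPosMeasure]

/-- If `π n` couples `μ n` with `ν` with distortion tending to zero, then every sequence of
automorphisms of the spaces `X n` subconverges to an automorphism of the limit space. -/
theorem exists_subseq_approx {X : ℕ → Type*} [∀ n, MetricSpace (X n)]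
    [∀ n, MeasurableSpace (X n)] [∀ n, BorelSpace (X n)]
    {μ : ∀ n, Measure (X n)} {π : ∀ n, Measure (X n × Y)} [∀ n, IsProbabilityMeasure (π n)]
    (hπ : ∀ n, π n ∈ couplings (μ n) ν) {ε : ℕ → ℝ} (hε : Tendsto ε atTop (𝓝 0))
    (hid : ∀ n, Approx (π n) id id (ε n)) {g : ∀ n, X n → X n} (hg : ∀ n, IsAut (μ n) (g n)) :
    ∃ φ : ℕ → ℕ, StrictMono φ ∧ ∃ h, IsAut ν h ∧
      ∀ δ > 0, ∀ᶠ n in atTop, Approx (π (φ n)) (g (φ n)) h δ := by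
  have : Nonempty Y := nonempty_of_isProbabilityMeasure ν
  have : ∀ n, Nonempty (X n × Y) := fun n => nonempty_of_isProbabilityMeasure (π n)
  have hev : ∀ δ > 0, ∀ᶠ n in atTop, ε n < δ := fun δ hδ => hε.eventually (gt_mem_nhds hδ)
  choose S hSm hSd using hid
  simp only [id] at hSd
  set u := denseSeq Y
  have hu : DenseRange u := denseRange_denseSeq Y
  have hinv : ∀ r > 0, ∀ᶠ n : ℕ in atTop, 1 / ((n : ℝ) + 1) < r := fun r hr =>
    tendsto_one_div_add_atTop_nhds_zero_nat.eventually (gt_mem_nhds hr)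
  choose p hp0 using fun n i =>
    exists_mem_dist_lt_infDist_add (S n) Prod.snd (u i) (Nat.one_div_pos_of_nat (α := ℝ) (n := n))
  choose q hq0 using fun n i => exists_mem_dist_lt_infDist_add (S n) Prod.fst (g n (p n i).1)
    (Nat.one_div_pos_of_nat (α := ℝ) (n := n))
  have hc : ∀ i, ∀ r > 0, 0 < ν.real (ball (u i) r) := fun i r hr =>
    ENNReal.toReal_pos (measure_ball_pos ν _ hr).ne' (measure_ne_top _ _)
  have hp : ∀ i, ∀ r > 0, ∀ᶠ n in atTop, p n i ∈ S n ∧ dist (u i) (p n i).2 < r := by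
    intro i r hr
    filter_upwards [hev _ (hc i (r / 2) (half_pos hr)), hinv (r / 2) (half_pos hr)] with n h1 h2
    obtain ⟨s, hs, hsu⟩ := exists_snd_mem_of_lt (hπ n) measurableSet_ball ((hSm n).trans_lt h1)
    obtain ⟨h3, h4⟩ := hp0 n i ⟨s, hs⟩
    have h5 := infDist_le_dist_of_mem (x := u i) (mem_image_of_mem Prod.snd hs)
    rw [mem_ball'] at hsu
    exact ⟨h3, by linarith⟩
  have hmass : ∀ i, ∀ r > 0, ∀ᶠ n in atTop,
      ν.real (ball (u i) r) ≤ (μ n).real (ball (g n (p n i).1) (3 * r)) + ε n := by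
    intro i r hr
    filter_upwards [hp i r hr, hev r hr] with n h1 h2
    rw [(hg n).measureReal_ball]
    refine (measureReal_le_of_snd_fst (hπ n) (S := S n) measurableSet_ball measurableSet_ball
      fun s hs hsu => ?_).trans (add_le_add_right (hSm n) _)
    rw [mem_ball] at hsu ⊢
    linarith [abs_le.1 (hSd n s hs (p n i) h1.1), dist_triangle s.2 (u i) (p n i).2]
  have hq : ∀ i, ∀ r > 0, ∀ᶠ n in atTop, q n i ∈ S n ∧ dist (g n (p n i).1) (q n i).1 < r := by
    intro i r hr
    have hr6 : 0 < r / 6 := by positivity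
    filter_upwards [hmass i _ hr6, hev _ (half_pos (hc i _ hr6)), hinv (r / 2) (half_pos hr)]
      with n h1 h2 h3
    obtain ⟨s, hs, hsg⟩ := exists_fst_mem_of_lt (hπ n) (S := S n)
      (A := ball (g n (p n i).1) (3 * (r / 6))) measurableSet_ball (by linarith [hSm n])
    obtain ⟨h4, h5⟩ := hq0 n i ⟨s, hs⟩
    have h6 := infDist_le_dist_of_mem (x := g n (p n i).1) (mem_image_of_mem Prod.fst hs)
    rw [mem_ball'] at hsg
    exact ⟨h4, by linarith⟩
  have htb : ∀ i, TotallyBounded (range fun n => (q n i).2) := by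
    intro i
    refine totallyBounded_range_of_eventually fun R hR => ?_
    obtain ⟨r, hr, hrR⟩ : ∃ r > 0, R = 6 * r := ⟨R / 6, by positivity, by ring⟩
    have hcr := hc i r hr
    obtain ⟨N, hN⟩ := exists_finite_cover_measureReal_compl_lt (ν := ν) hu hr (half_pos hcr)
    refine ⟨u '' Iic N, (finite_Iic N).image u, ?_⟩
    filter_upwards [hmass i r hr, hq i r hr, hev r hr, hev _ (show 0 < ν.real (ball (u i) r) / 4 by positivity)]
      with n h1 h2 h3 h4
    have h5 : (μ n).real (ball (g n (p n i).1) (3 * r)) ≤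
        ν.real (ball (q n i).2 (5 * r)) + (π n).real (S n)ᶜ := by
      refine measureReal_le_of_fst_snd (hπ n) measurableSet_ball measurableSet_ball
        fun s hs hsg => ?_
      rw [mem_ball] at hsg ⊢
      linarith [abs_le.1 (hSd n s hs (q n i) h2.1),
        dist_triangle s.1 (g n (p n i).1) (q n i).1]
    by_contra! hfar
    have h6 : ball (q n i).2 (5 * r) ⊆ (⋃ i ≤ N, ball (u i) r)ᶜ := by
      intro y hy hyc
      simp only [mem_iUnion] at hyc
      obtain ⟨k, hk, hyk⟩ := hyc
      have := hfar (u k) ⟨k, hk, rfl⟩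
      rw [mem_ball'] at hy
      rw [mem_ball] at hyk
      linarith [dist_triangle (q n i).2 y (u k)]
    linarith [measureReal_mono (μ := ν) h6, hSm n]
  obtain ⟨v, -, φ, hφ, hv⟩ := (isCompact_univ_pi fun i =>
    (htb i).closure.isCompact_of_isClosed isClosed_closure).tendsto_subseq (x := fun n i => (q n i).2)
    fun n i _ => subset_closure (mem_range_self n)
  have hv' : ∀ i, ∀ r > 0, ∀ᶠ n in atTop, dist (q (φ n) i).2 (v i) < r := fun i r hr =>
    (tendsto_pi_nhds.1 hv i).eventually (ball_mem_nhds _ hr)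
  have hφt := hφ.tendsto_atTop
  have hpq : ∀ i, ∀ r > 0, ∀ᶠ n in atTop, (p (φ n) i ∈ S (φ n) ∧ dist (u i) (p (φ n) i).2 < r) ∧
      (q (φ n) i ∈ S (φ n) ∧ dist (g (φ n) (p (φ n) i).1) (q (φ n) i).1 < r) ∧
      dist (q (φ n) i).2 (v i) < r := fun i r hr =>
    (hφt.eventually (hp i r hr)).and ((hφt.eventually (hq i r hr)).and (hv' i r hr))
  have huv : ∀ i j, dist (v i) (v j) = dist (u i) (u j) := by
    intro i j
    refine eq_of_forall_dist_le fun r hr => ?_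
    have hr8 : 0 < r / 8 := by positivity
    obtain ⟨n, ⟨⟨pi, dpi⟩, ⟨qi, dqi⟩, vi⟩, ⟨⟨pj, dpj⟩, ⟨qj, dqj⟩, vj⟩, hn⟩ :=
      ((hpq i _ hr8).and ((hpq j _ hr8).and (hφt.eventually (hev _ hr8)))).exists
    have e1 := abs_le.1 (hSd _ _ pi _ pj)
    have e2 := abs_le.1 (hSd _ _ qi _ qj)
    rw [← (hg (φ n)).1.dist_eq] at e1
    have e3 := (dist_dist_dist_le (v i) (v j) (q (φ n) i).2 (q (φ n) j).2)
    have e4 := (dist_dist_dist_le (u i) (u j) (p (φ n) i).2 (p (φ n) j).2)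
    have e5 := (dist_dist_dist_le (g (φ n) (p (φ n) i).1) (g (φ n) (p (φ n) j).1)
      (q (φ n) i).1 (q (φ n) j).1)
    rw [Real.dist_eq, abs_le] at e3 e4 e5
    rw [dist_comm (v i) (q _ _).2, dist_comm (v j) (q _ _).2] at e3
    rw [Real.dist_eq, abs_le]
    constructor <;> linarith
  obtain ⟨h, hh, hhu⟩ := exists_isometry_extension hu huv
  have happrox : ∀ δ > 0, ∀ᶠ n in atTop, Approx (π (φ n)) (g (φ n)) h δ := by
    intro δ hδ
    obtain ⟨r, hr, rfl⟩ : ∃ r > 0, δ = 10 * r := ⟨δ / 10, by positivity, by ring⟩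
    obtain ⟨N, hN⟩ := exists_finite_cover_measureReal_compl_lt (ν := ν) hu hr hr
    have hall := (eventually_all_finite (finite_Iic N)).2 fun i _ => hpq i r hr
    filter_upwards [hall, hφt.eventually (hev r hr)] with n h1 h2
    have hm : MeasurableSet (⋃ i ≤ N, ball (u i) r) :=
      MeasurableSet.biUnion (to_countable _) fun i _ => measurableSet_ball
    refine ⟨S (φ n) ∩ Prod.snd ⁻¹' (⋃ i ≤ N, ball (u i) r), ?_, ?_⟩
    · rw [compl_inter, ← preimage_compl]
      refine (measureReal_union_le _ _).trans ?_
      rw [measureReal_snd_preimage (hπ (φ n)) hm.compl]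
      linarith [hSm (φ n)]
    · rintro s ⟨hs, hsu⟩ t ⟨ht, -⟩
      simp only [mem_preimage, mem_iUnion] at hsu
      obtain ⟨i, hi, hsi⟩ := hsu
      obtain ⟨⟨pi, dpi⟩, ⟨qi, dqi⟩, vi⟩ := h1 i hi
      rw [mem_ball] at hsi
      have e1 := abs_le.1 (hSd _ _ hs _ pi)
      have e2 := abs_le.1 (hSd _ _ qi _ ht)
      have e3 : dist (g (φ n) s.1) (g (φ n) (p (φ n) i).1) = _ := (hg (φ n)).1.dist_eq _ _
      have e4 : dist (h s.2) (v i) = _ := (hhu i ▸ hh.dist_eq s.2 (u i))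
      have e5 := abs_le.1 (abs_dist_sub_le (g (φ n) s.1) (g (φ n) (p (φ n) i).1) t.1)
      have e6 := abs_le.1 (abs_dist_sub_le (g (φ n) (p (φ n) i).1) (q (φ n) i).1 t.1)
      have e7 := abs_le.1 (abs_dist_sub_le (q (φ n) i).2 (v i) t.2)
      have e8 := abs_le.1 (abs_dist_sub_le (h s.2) (v i) t.2)
      have e9 := dist_triangle s.2 (u i) (p (φ n) i).2
      rw [abs_le]
      constructor <;> linarith
  refine ⟨φ, hφ, h, isAut_of_measureReal_preimage_le hh fun F hF => ?_, happrox⟩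
  have hlim : Tendsto (fun r : ℝ => ν.real (thickening r F)) (𝓝[>] 0) (𝓝 (ν.real F)) :=
    (ENNReal.tendsto_toReal (measure_ne_top _ _)).comp
      (tendsto_measure_thickening_of_isClosed ⟨1, one_pos, measure_ne_top _ _⟩ hF)
  have hlim2 : Tendsto (fun r : ℝ => ν.real (thickening r F) + 6 * (r / 4)) (𝓝[>] 0)
      (𝓝 (ν.real F + 6 * (0 / 4))) :=
    hlim.add ((tendsto_nhdsWithin_of_tendsto_nhds tendsto_id).div_const 4 |>.const_mul 6)
  rw [zero_div, mul_zero, add_zero] at hlim2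
  refine ge_of_tendsto hlim2 (eventually_nhdsWithin_of_forall fun r (hr : 0 < r) => ?_)
  have hr4 : 0 < r / 4 := by positivity
  obtain ⟨n, h1, h2⟩ := ((happrox _ hr4).and (hφt.eventually (hev _ hr4))).exists
  have hid' : Approx (π (φ n)) id id (r / 4) := ⟨S (φ n), (hSm _).trans h2.le,
    fun s hs t ht => (hSd _ s hs t ht).trans h2.le⟩
  have := h1.measureReal_preimage_le (hπ _) (hg _) hh.continuous hr4 hid' hF.measurableSet
  rwa [mul_div_cancel₀ _ (by norm_num : (4 : ℝ) ≠ 0)] at this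

/-- The automorphism group is sequentially compact with respect to convergence in measure. -/
theorem exists_subseq_closeInMeasure {h : ℕ → Y → Y} (hh : ∀ n, IsAut ν (h n)) :
    ∃ φ : ℕ → ℕ, StrictMono φ ∧ ∃ h', IsAut ν h' ∧
      ∀ δ > 0, ∀ᶠ n in atTop, CloseInMeasure ν (h (φ n)) h' δ := by
  have hd : Measurable fun y : Y => (y, y) := by fun_prop
  set τ : Measure (Y × Y) := ν.map fun y => (y, y) with hτ
  have : IsProbabilityMeasure τ := Measure.isProbabilityMeasure_map hd.aemeasurable
  have hτc : τ ∈ couplings ν ν := by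
    constructor
    · rw [hτ, Measure.map_map measurable_fst hd]; exact Measure.map_id
    · rw [hτ, Measure.map_map measurable_snd hd]; exact Measure.map_id
  have hτid : Approx τ id id 0 := by
    refine ⟨diagonal Y, ?_, ?_⟩
    · rw [hτ, map_measureReal_apply hd isClosed_diagonal.measurableSet.compl]
      have : (fun y : Y => (y, y)) ⁻¹' (diagonal Y)ᶜ = ∅ := by ext; simp
      rw [this, measureReal_empty]
    · rintro ⟨a, b⟩ hab ⟨c, d⟩ hcd
      rw [mem_diagonal_iff] at hab hcd
      simp_all
  obtain ⟨φ, hφ, h', hh', H⟩ := exists_subseq_approx (μ := fun _ => ν) (π := fun _ => τ)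
    (fun _ => hτc) tendsto_const_nhds (fun _ => hτid) hh
  refine ⟨φ, hφ, h', hh', fun δ hδ => ?_⟩
  have hδ4 : 0 < δ / 4 := by positivity
  filter_upwards [H _ hδ4] with n hn
  obtain ⟨S, h1, h2⟩ := hn
  have hT : ν.real ((fun y : Y => (y, y)) ⁻¹' Sᶜ) ≤ δ / 4 := by
    refine le_trans (ENNReal.toReal_mono (measure_ne_top _ _) ?_) h1
    exact Measure.le_map_apply hd.aemeasurable _
  set A : Set Y := (fun y : Y => (y, y)) ⁻¹' S
  have hA : MeasurableSet (thickening (δ / 4) A) := isOpen_thickening.measurableSet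
  have h3 : ν.real ((h (φ n)) ⁻¹' (thickening (δ / 4) A)ᶜ) ≤ δ / 4 := by
    rw [(hh _).measureReal_preimage hA.compl]
    exact (measureReal_mono (compl_subset_compl.2 (self_subset_thickening hδ4 A))).trans hT
  have hsub : {y | δ < dist (h (φ n) y) (h' y)} ⊆ Aᶜ ∪ (h (φ n)) ⁻¹' (thickening (δ / 4) A)ᶜ := by
    intro y hy
    by_contra hcon
    simp only [mem_union, not_or, mem_compl_iff, not_not, mem_preimage] at hcon
    obtain ⟨z, hz, hd⟩ := mem_thickening_iff.1 hcon.2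
    have e1 := abs_le.1 (h2 _ hcon.1 _ hz)
    simp only at e1
    have e2 := dist_triangle_right (h (φ n) y) (h' y) z
    have e3 : δ < dist (h (φ n) y) (h' y) := hy
    linarith
  refine (measureReal_mono hsub).trans ((measureReal_union_le _ _).trans ?_)
  have : ν.real Aᶜ ≤ δ / 4 := hT
  linarith

end Compactness

section Properness

/-- A sequence of Boolean valued families over a countable index is pointwise eventually
constant along a subsequence. -/
lemma exists_subseq_eventually_const {ι : Type*} [Countable ι] (P : ℕ → ι → Prop) :
    ∃ φ : ℕ → ℕ, StrictMono φ ∧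
      ∀ i, (∃ᶠ n in atTop, P (φ n) i) → ∀ᶠ n in atTop, P (φ n) i := by
  classical
  obtain ⟨a, φ, hφ, ha⟩ := CompactSpace.tendsto_subseq fun n i => decide (P n i)
  refine ⟨φ, hφ, fun i hi => ?_⟩
  have h1 := tendsto_pi_nhds.1 ha i
  rw [nhds_discrete, tendsto_pure] at h1
  obtain ⟨n, hn, hn'⟩ := (hi.and_eventually h1).exists
  filter_upwards [h1] with m hm
  simp only [Function.comp_apply] at hm hn'
  rw [← hn'] at hm
  simpa [hn] using hm

lemma eqBox_le {X Y : Type*} [MetricSpace X] [MetricSpace Y] [MeasurableSpace X]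
    [MeasurableSpace Y] [BorelSpace X] [BorelSpace Y] [SecondCountableTopology X]
    [SecondCountableTopology Y] {μ : Measure X} {ν : Measure Y} {π : Measure (X × Y)}
    [IsProbabilityMeasure π] (hπ : π ∈ couplings μ ν) {G : Set (X → X)} {H : Set (Y → Y)}
    (hG : ∀ g ∈ G, Continuous g) (hH : ∀ h ∈ H, Continuous h) {δ : ℝ}
    (hGH : ∀ g ∈ G, ∃ h ∈ H, Approx π g h δ) (hHG : ∀ h ∈ H, ∃ g ∈ G, Approx π g h δ) :
    eqBox μ ν G H ≤ ENNReal.ofReal δ := by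
  refine iInf₂_le_of_le π hπ (max_le (iSup₂_le fun g hg => ?_) (iSup₂_le fun h hh => ?_))
  · obtain ⟨h, hh, ha⟩ := hGH g hg
    exact iInf₂_le_of_le h hh (ha.dPi_le (hG g hg) (hH h hh))
  · obtain ⟨g, hg, ha⟩ := hHG h hh
    exact iInf₂_le_of_le g hg (ha.dPi_le (hG g hg) (hH h hh))

lemma exists_coupling_approx_of_eqBox_lt {X Y : Type*} [MetricSpace X] [MetricSpace Y]
    [MeasurableSpace X] [MeasurableSpace Y] [BorelSpace X] [BorelSpace Y]
    [SecondCountableTopology Y] {μ : Measure X} {ν : Measure Y} [IsProbabilityMeasure μ] {ε : ℝ}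
    (hε : 0 ≤ ε) (H : eqBox μ ν {id} {id} < ENNReal.ofReal ε) :
    ∃ π ∈ couplings μ ν, Approx π id id ε := by
  simp only [eqBox, iInf_lt_iff] at H
  obtain ⟨π, hπ, h1⟩ := H
  have := isProbabilityMeasure_of_mem_couplings hπ
  refine ⟨π, hπ, approx_of_dPi_lt hε ?_⟩
  simpa [boxPi] using h1

variable {Y : Type*} [MetricSpace Y] [CompleteSpace Y] [SecondCountableTopology Y]
  [MeasurableSpace Y] [BorelSpace Y] {ν : Measure Y} [IsProbabilityMeasure ν]
  [ν.IsOpenPosMeasure]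
  {X : ℕ → Type*} [∀ n, MetricSpace (X n)]
  [∀ n, MeasurableSpace (X n)] [∀ n, BorelSpace (X n)]
  {μ : ∀ n, Measure (X n)} {π : ∀ n, Measure (X n × Y)} [∀ n, IsProbabilityMeasure (π n)]
  {G : ∀ n, Set (X n → X n)}

/-- The automorphisms of the limit space that are limits of elements of `G n` through `π n`. -/
def limitAut (ν : Measure Y) (π : ∀ n, Measure (X n × Y)) (G : ∀ n, Set (X n → X n)) :
    Set (Y → Y) :=
  {h | IsAut ν h ∧ ∀ δ > 0, ∀ᶠ n in atTop, ∃ g ∈ G n, Approx (π n) g h δ}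

lemma mem_limitAut_of_closeInMeasure (hπ : ∀ n, π n ∈ couplings (μ n) ν) {h : Y → Y}
    (hh : IsAut ν h) (H : ∀ η > 0, ∃ h' ∈ limitAut ν π G, CloseInMeasure ν h' h η) :
    h ∈ limitAut ν π G := by
  refine ⟨hh, fun δ hδ => ?_⟩
  obtain ⟨h', hh', hc⟩ := H _ (half_pos hδ)
  filter_upwards [hh'.2 _ (half_pos hδ)] with n hn
  obtain ⟨g, hg, ha⟩ := hn
  refine ⟨g, hg, ?_⟩
  simpa using ha.of_closeInMeasure (hπ n) hh'.1.1.continuous hh.1.continuous hc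

lemma isClosedAutSubgroup_limitAut (hπ : ∀ n, π n ∈ couplings (μ n) ν)
    (hG : ∀ n, IsClosedAutSubgroup (μ n) (G n)) {ε : ℕ → ℝ} (hε : Tendsto ε atTop (𝓝 0))
    (hid : ∀ n, Approx (π n) id id (ε n)) : IsClosedAutSubgroup ν (limitAut ν π G) := by
  refine ⟨fun h hh => hh.1, ⟨isAut_id, fun δ hδ => ?_⟩, fun h hh h' hh' => ?_, fun h hh => ?_,
    fun hs h hmem haut hlim => ?_⟩
  · filter_upwards [hε.eventually (gt_mem_nhds hδ)] with n hn
    exact ⟨id, (hG n).2.1, (hid n).mono hn.le⟩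
  · refine ⟨hh.1.comp hh'.1, fun δ hδ => ?_⟩
    have hδ4 : 0 < δ / 4 := by positivity
    filter_upwards [hh.2 _ hδ4, hh'.2 _ hδ4] with n h1 h2
    obtain ⟨g, hg, ha⟩ := h1
    obtain ⟨g', hg', ha'⟩ := h2
    refine ⟨g ∘ g', (hG n).2.2.1 g hg g' hg', ?_⟩
    exact (ha.comp (hπ n) ((hG n).1 g hg).1 ((hG n).1 g' hg') hh.1.1 hδ4 ha').mono
      (by linarith)
  · obtain ⟨k, hk, hkh, hhk⟩ := hh.1.exists_inverse
    refine ⟨k, ⟨hk, fun δ hδ => ?_⟩, hkh, hhk⟩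
    filter_upwards [hh.2 δ hδ] with n hn
    obtain ⟨g, hg, ha⟩ := hn
    obtain ⟨g', hg', -, hgg'⟩ := (hG n).2.2.2.1 g hg
    exact ⟨g', hg', ha.inverse ((hG n).1 g hg).1 hh.1.1 hgg' hhk⟩
  · refine mem_limitAut_of_closeInMeasure hπ haut fun η hη => ?_
    obtain ⟨n, hn⟩ := (hlim.eventually (gt_mem_nhds hη)).exists
    exact ⟨hs n, hmem n, closeInMeasure_of_kyFan_lt hn⟩

lemma eventually_forall_limitAut_exists_approx (hπ : ∀ n, π n ∈ couplings (μ n) ν) {δ : ℝ}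
    (hδ : 0 < δ) :
    ∀ᶠ n in atTop, ∀ h ∈ limitAut ν π G, ∃ g ∈ G n, Approx (π n) g h δ := by
  by_contra hcon
  obtain ⟨φ, hφ, hbad⟩ := extraction_of_frequently_atTop (not_eventually.1 hcon)
  push Not at hbad
  choose h hh hbad using hbad
  obtain ⟨φ', hφ', h', hh', hlim⟩ := exists_subseq_closeInMeasure fun n => (hh n).1
  have hmem : h' ∈ limitAut ν π G := mem_limitAut_of_closeInMeasure hπ hh' fun η hη => by
    obtain ⟨n, hn⟩ := (hlim η hη).exists
    exact ⟨_, hh _, hn⟩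
  have hev := (hφ.comp hφ').tendsto_atTop.eventually (hmem.2 _ (half_pos hδ))
  obtain ⟨n, ⟨g, hg, ha⟩, hn⟩ := (hev.and (hlim _ (half_pos hδ))).exists
  refine hbad (φ' n) g hg ?_
  simpa using ha.of_closeInMeasure (hπ _) hh'.1.continuous (hh _).1.1.continuous hn.symm

lemma eventually_forall_exists_limitAut_approx (hπ : ∀ n, π n ∈ couplings (μ n) ν)
    (hG : ∀ n, IsClosedAutSubgroup (μ n) (G n)) {ε : ℕ → ℝ} (hε : Tendsto ε atTop (𝓝 0))
    (hid : ∀ n, Approx (π n) id id (ε n))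
    (hfreq : ∀ h, IsAut ν h → (∀ δ > 0, ∃ᶠ n in atTop, ∃ g ∈ G n, Approx (π n) g h δ) →
      h ∈ limitAut ν π G) {δ : ℝ} (hδ : 0 < δ) :
    ∀ᶠ n in atTop, ∀ g ∈ G n, ∃ h ∈ limitAut ν π G, Approx (π n) g h δ := by
  by_contra hcon
  obtain ⟨φ, hφ, hbad⟩ := extraction_of_frequently_atTop (not_eventually.1 hcon)
  push Not at hbad
  choose g hg hbad using hbad
  obtain ⟨φ', hφ', h, hh, hlim⟩ := exists_subseq_approx (fun n => hπ (φ n))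
    (hε.comp hφ.tendsto_atTop) (fun n => hid (φ n)) (fun n => (hG (φ n)).1 _ (hg n))
  have hmem : h ∈ limitAut ν π G := hfreq h hh fun η hη =>
    (hφ.comp hφ').tendsto_atTop.frequently
      ((hlim η hη).mono fun n hn => ⟨_, hg (φ' n), hn⟩).frequently
  obtain ⟨n, hn⟩ := (hlim δ hδ).exists
  exact hbad (φ' n) h hmem hn

/-- Along a subsequence, every automorphism of the limit space that is frequently
approximated by elements of `G n` is eventually approximated. -/
lemma exists_subseq_frequently_mem_limitAut (hπ : ∀ n, π n ∈ couplings (μ n) ν) :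
    ∃ φ : ℕ → ℕ, StrictMono φ ∧ ∀ h, IsAut ν h →
      (∀ δ > 0, ∃ᶠ n in atTop, ∃ g ∈ G (φ n), Approx (π (φ n)) g h δ) →
      h ∈ limitAut ν (fun n => π (φ n)) (fun n => G (φ n)) := by
  obtain ⟨D, hD, hdense⟩ := exists_dense_seq_isAut (ν := ν)
  obtain ⟨φ, hφ, H⟩ := exists_subseq_eventually_const
    fun n (i : ℕ × ℕ) => ∃ g ∈ G n, Approx (π n) g (D i.1) (1 / ((i.2 : ℝ) + 1))
  refine ⟨φ, hφ, fun h hh hfreq => ⟨hh, fun δ hδ => ?_⟩⟩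
  obtain ⟨m, hm⟩ := exists_nat_one_div_lt (half_pos hδ)
  set η : ℝ := 1 / ((m : ℝ) + 1) with hη
  have hη0 : 0 < η := Nat.one_div_pos_of_nat
  obtain ⟨k, hk⟩ := hdense h hh (η / 2) (half_pos hη0)
  have hev := H (k, m) ((hfreq _ (half_pos hη0)).mono fun n ⟨g, hg, ha⟩ => ⟨g, hg,
    (ha.of_closeInMeasure (hπ _) hh.1.continuous (hD k).1.continuous hk).mono (add_halves η).le⟩)
  filter_upwards [hev] with n hn
  obtain ⟨g, hg, ha⟩ := hn
  refine ⟨g, hg, (ha.of_closeInMeasure (hπ _) (hD k).1.continuous hh.1.continuous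
    hk.symm).mono ?_⟩
  simp only [← hη]
  linarith

end Properness

/-- properness of the projection `(X,G) ↦ X`: if `Xₙ` box converges
to `Y`, then along a subsequence the group actions converge equivariantly to some
closed subgroup `H ⊆ Aut(Y)`. -/
theorem stmt_19 (X : ℕ → Type*) [∀ n, MetricSpace (X n)] [∀ n, CompleteSpace (X n)]
    [∀ n, SeparableSpace (X n)] [∀ n, MeasurableSpace (X n)] [∀ n, BorelSpace (X n)]
    (μ : ∀ n, Measure (X n)) [∀ n, IsProbabilityMeasure (μ n)]
    [∀ n, (μ n).IsOpenPosMeasure]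
    (G : ∀ n, Set (X n → X n)) (hG : ∀ n, IsClosedAutSubgroup (μ n) (G n))
    {Y : Type*} [MetricSpace Y] [CompleteSpace Y] [SeparableSpace Y] [MeasurableSpace Y] [BorelSpace Y]
    (ν : Measure Y) [IsProbabilityMeasure ν] [ν.IsOpenPosMeasure]
    (hconv : Tendsto (fun n => eqBox (μ n) ν
      ({id} : Set (X n → X n)) ({id} : Set (Y → Y))) atTop (𝓝 0)) :
    ∃ ι : ℕ → ℕ, StrictMono ι ∧ ∃ H : Set (Y → Y), IsClosedAutSubgroup ν H ∧
      Tendsto (fun j => eqBox (μ (ι j)) ν (G (ι j)) H) atTop (𝓝 0) := by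
  have := fun n => UniformSpace.secondCountable_of_separable (X n)
  have := UniformSpace.secondCountable_of_separable Y
  have hfin : ∀ n, eqBox (μ n) ν {id} {id} ≠ ∞ := fun n => by
    have hle : eqBox (μ n) ν {id} {id} ≤ ENNReal.ofReal 1 :=
      eqBox_le prod_mem_couplings (by simp [continuous_id]) (by simp [continuous_id])
        (fun g _ => ⟨id, rfl, approx_one⟩) (fun h _ => ⟨id, rfl, approx_one⟩)
    exact (hle.trans_lt ENNReal.ofReal_lt_top).ne
  set ε : ℕ → ℝ := fun n => (eqBox (μ n) ν {id} {id}).toReal + 1 / ((n : ℝ) + 1)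
  have hε : Tendsto ε atTop (𝓝 0) := by
    have h := ((ENNReal.tendsto_toReal ENNReal.zero_ne_top).comp hconv).add
      (tendsto_one_div_add_atTop_nhds_zero_nat (𝕜 := ℝ))
    rwa [ENNReal.toReal_zero, add_zero] at h
  have hlt : ∀ n, (eqBox (μ n) ν {id} {id}).toReal < ε n := fun n =>
    lt_add_of_pos_right _ Nat.one_div_pos_of_nat
  choose π hπ hid using fun n => exists_coupling_approx_of_eqBox_lt
    (ENNReal.toReal_nonneg.trans (hlt n).le)
    ((ENNReal.lt_ofReal_iff_toReal_lt (hfin n)).2 (hlt n))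
  have := fun n => isProbabilityMeasure_of_mem_couplings (hπ n)
  obtain ⟨ι, hι, hfreq⟩ := exists_subseq_frequently_mem_limitAut (G := G) hπ
  have hπ' := fun n => hπ (ι n)
  have hid' := fun n => hid (ι n)
  have hε' := hε.comp hι.tendsto_atTop
  have hG' := fun n => hG (ι n)
  refine ⟨ι, hι, _, isClosedAutSubgroup_limitAut hπ' hG' hε' hid', ?_⟩
  refine ENNReal.tendsto_nhds_zero.2 fun δ hδ => ?_
  obtain ⟨r, hr, hrδ⟩ := ENNReal.lt_iff_exists_nnreal_btwn.1 hδ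
  have hr0 : (0 : ℝ) < r := by exact_mod_cast hr
  filter_upwards [eventually_forall_limitAut_exists_approx hπ' hr0,
    eventually_forall_exists_limitAut_approx hπ' hG' hε' hid' hfreq hr0] with n h1 h2
  refine (eqBox_le (hπ' n) (fun g hg => ((hG' n).1 g hg).1.continuous)
    (fun h hh => hh.1.1.continuous) h2 h1).trans ?_
  rw [ENNReal.ofReal_coe_nnreal]
  exact hrδ.le

end
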